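/- arXiv:1201.5756 — 2 statements merged into one kernel-verified Lean document; each statement's English description precedes it below -/
import Mathlib

section
/- Let π be a strictly positive probability on {−1,1}^V whose Dobrushin coefficients satisfy max_{i∈V} Σ_{j≠i} γ_{ij} ≤ γ < 1, and let J̄ ≥ max_{i∈V} Σ_{j∈V} |J_{ij}|. Then there is a constant C depending only on J̄ and γ (one may take C = e^{4J̄}(1+4J̄)²/(1−γ)) such that for every δ ≥ 0, (1/|V|) Var_π[ Σ_{i∈V} φ_i/(1+δφ_i) ] ≤ C. -/
open Finset

section defs

/-- The spin value of a Boolean: `true ↦ 1`, `false ↦ -1`. -/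
def spin (b : Bool) : ℝ := if b then 1 else -1

variable {ι : Type*} [Fintype ι] [DecidableEq ι]

/-- The configuration `σ` with the spin at site `j` flipped. -/
def flipAt (σ : ι → Bool) (j : ι) : ι → Bool := Function.update σ j (!σ j)

/-- `ρ_j(g) = max_σ |g(σ) - g(σ^j)|`. -/
noncomputable def rho (j : ι) (g : (ι → Bool) → ℝ) : ℝ :=
  Finset.univ.sup' Finset.univ_nonempty fun σ => |g σ - g (flipAt σ j)|

/-- Expectation of `g` under the (finitely supported) measure `π`. -/
noncomputable def Emean {α : Type*} [Fintype α] (π g : α → ℝ) : ℝ := ∑ x, π x * g x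

/-- Variance of `g` under `π`. -/
noncomputable def Var {α : Type*} [Fintype α] (π g : α → ℝ) : ℝ :=
  Emean π (fun x => g x ^ 2) - (Emean π g) ^ 2

/-- Covariance of `f` and `g` under `π`. -/
noncomputable def Cov {α : Type*} [Fintype α] (π f g : α → ℝ) : ℝ :=
  Emean π (fun x => f x * g x) - Emean π f * Emean π g

/-- Total variation distance `(1/2) Σ_x |μ(x) - ν(x)|`. -/
noncomputable def tv {α : Type*} [Fintype α] (μ ν : α → ℝ) : ℝ :=
  (1 / 2) * ∑ x, |μ x - ν x|

/-- `h_i(σ) = -Σ_j J_{ij} σ_j`. -/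
noncomputable def hfun (J : ι → ι → ℝ) (i : ι) (σ : ι → Bool) : ℝ :=
  -∑ j, J i j * spin (σ j)

/-- `h_{i,l}(σ) = -Σ_{j ≠ l} J_{ij} σ_j`. -/
noncomputable def hil (J : ι → ι → ℝ) (i l : ι) (σ : ι → Bool) : ℝ :=
  -∑ j ∈ Finset.univ.erase l, J i j * spin (σ j)

/-- `H(σ) = -Σ_{i,j} J_{ij} σ_i σ_j` (equals `-Σ_{i≠j}` since `J_{ii}=0`). -/
noncomputable def Ham (J : ι → ι → ℝ) (σ : ι → Bool) : ℝ :=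
  -∑ i, ∑ j, J i j * spin (σ i) * spin (σ j)

/-- The Gibbs measure `π^G(σ) = e^{-H(σ)} / Σ_τ e^{-H(τ)}`. -/
noncomputable def piG (J : ι → ι → ℝ) (σ : ι → Bool) : ℝ :=
  Real.exp (-Ham J σ) / ∑ τ : ι → Bool, Real.exp (-Ham J τ)

/-- `φ_i(σ) = exp(-2 Σ_j J_{ij} σ_i σ_j)`. -/
noncomputable def phi (J : ι → ι → ℝ) (i : ι) (σ : ι → Bool) : ℝ :=
  Real.exp (-2 * ∑ j, J i j * spin (σ i) * spin (σ j))

/-- `f_δ(σ) = Π_i (1 + δ φ_i(σ))`. -/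
noncomputable def fδ (J : ι → ι → ℝ) (δ : ℝ) (σ : ι → Bool) : ℝ :=
  ∏ i, (1 + δ * phi J i σ)

/-- The PCA stationary measure `π^{PCA}(σ) = π^G(σ) f(σ) / π^G(f)`. -/
noncomputable def piPCA (J : ι → ι → ℝ) (δ : ℝ) (σ : ι → Bool) : ℝ :=
  piG J σ * fδ J δ σ / Emean (piG J) (fδ J δ)

/-- The measure `π̃(σ) = π^G(σ) f(σ)² / π^G(f²)`. -/
noncomputable def piTilde (J : ι → ι → ℝ) (δ : ℝ) (σ : ι → Bool) : ℝ :=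
  piG J σ * (fδ J δ σ) ^ 2 / Emean (piG J) (fun τ => (fδ J δ τ) ^ 2)

/-- `Σ_{i∈V} φ_i/(1 + δ φ_i)`. -/
noncomputable def Gsum (J : ι → ι → ℝ) (δ : ℝ) (σ : ι → Bool) : ℝ :=
  ∑ i, phi J i σ / (1 + δ * phi J i σ)

/-- The conditional probability `π(σ_i = 1 | σ restricted to V∖{i})`. -/
noncomputable def condProb (π : (ι → Bool) → ℝ) (i : ι) (σ : ι → Bool) : ℝ :=
  π (Function.update σ i true) /
    (π (Function.update σ i true) + π (Function.update σ i false))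

/-- The Dobrushin coefficient `γ_{ij} = max_σ |π(σ_i=1|σ_{∖i}) - π(σ_i=1|σ^j_{∖i})|`. -/
noncomputable def dobr (π : (ι → Bool) → ℝ) (i j : ι) : ℝ :=
  Finset.univ.sup' Finset.univ_nonempty fun σ =>
    |condProb π i σ - condProb π i (flipAt σ j)|

/-- `ψ_{i,δ}` from the local-specification computation. -/
noncomputable def psi (J : ι → ι → ℝ) (δ : ℝ) (i : ι) (σ : ι → Bool) : ℝ :=
  (1 / 2) *
    (Real.log ((1 + δ * Real.exp (-2 * hfun J i σ)) / (1 + δ * Real.exp (2 * hfun J i σ))) +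
      ∑ l ∈ Finset.univ.erase i,
        Real.log
          ((1 + δ * Real.exp (-2 * J i l * spin (σ l) - 2 * spin (σ l) * hil J i l σ)) /
            (1 + δ * Real.exp (2 * J i l * spin (σ l) - 2 * spin (σ l) * hil J i l σ))))

/-- The pair Hamiltonian `H(σ,σ') = Σ_i [h_i(σ) σ'_i + q(1 - σ_i σ'_i)]`. -/
noncomputable def Hpair (J : ι → ι → ℝ) (q : ℝ) (σ σ' : ι → Bool) : ℝ :=
  ∑ i, (hfun J i σ * spin (σ' i) + q * (1 - spin (σ i) * spin (σ' i)))

/-- `Z_σ = Σ_τ e^{-H(σ,τ)}`. -/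
noncomputable def Zconf (J : ι → ι → ℝ) (q : ℝ) (σ : ι → Bool) : ℝ :=
  ∑ τ : ι → Bool, Real.exp (-Hpair J q σ τ)

/-- The PCA transition probability `P^{PCA}_{σ,σ'} = e^{-H(σ,σ')}/Z_σ`. -/
noncomputable def Ppca (J : ι → ι → ℝ) (q : ℝ) (σ σ' : ι → Bool) : ℝ :=
  Real.exp (-Hpair J q σ σ') / Zconf J q σ

/-- The PCA stationary measure written as `π^{PCA}(σ) = Z_σ / Σ_τ Z_τ`. -/
noncomputable def piPCAq (J : ι → ι → ℝ) (q : ℝ) (σ : ι → Bool) : ℝ :=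
  Zconf J q σ / ∑ τ : ι → Bool, Zconf J q τ

end defs

/-- Restriction of an interaction on an infinite site space to a finite volume `V`. -/
def Jres {α : Type*} (J : α → α → ℝ) (V : Finset α) : ↥V → ↥V → ℝ :=
  fun a b => J a.1 b.1

section flip

variable {ι : Type*} [DecidableEq ι]

lemma flipAt_flipAt (σ : ι → Bool) (j : ι) : flipAt (flipAt σ j) j = σ := by
  simp [flipAt]

lemma flipAt_update_self (σ : ι → Bool) (i : ι) (b : Bool) :
    flipAt (Function.update σ i b) i = Function.update σ i (!b) := by
  simp [flipAt]

lemma update_flipAt_of_ne (σ : ι → Bool) {i j : ι} (h : j ≠ i) (b : Bool) :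
    Function.update (flipAt σ j) i b = flipAt (Function.update σ i b) j := by
  simp only [flipAt, Function.update_of_ne h]
  exact Function.update_comm h.symm b _ σ |>.symm

end flip

section oscillation

variable {ι : Type*} [Fintype ι] [DecidableEq ι]

lemma abs_sub_flipAt_le_rho (j : ι) (g : (ι → Bool) → ℝ) (σ : ι → Bool) :
    |g σ - g (flipAt σ j)| ≤ rho j g :=
  Finset.le_sup' (fun σ => |g σ - g (flipAt σ j)|) (Finset.mem_univ σ)

lemma rho_le {j : ι} {g : (ι → Bool) → ℝ} {c : ℝ}
    (h : ∀ σ, |g σ - g (flipAt σ j)| ≤ c) : rho j g ≤ c :=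
  Finset.sup'_le _ _ fun σ _ => h σ

lemma rho_nonneg (j : ι) (g : (ι → Bool) → ℝ) : 0 ≤ rho j g :=
  (abs_nonneg _).trans (abs_sub_flipAt_le_rho j g fun _ => true)

lemma abs_condProb_sub_le_dobr (π : (ι → Bool) → ℝ) (i j : ι) (σ : ι → Bool) :
    |condProb π i σ - condProb π i (flipAt σ j)| ≤ dobr π i j :=
  Finset.le_sup' (fun σ => |condProb π i σ - condProb π i (flipAt σ j)|) (Finset.mem_univ σ)

lemma abs_update_sub_update_le_rho (j : ι) (g : (ι → Bool) → ℝ) (σ : ι → Bool) (a b : Bool) :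
    |g (Function.update σ j a) - g (Function.update σ j b)| ≤ rho j g := by
  by_cases h : a = b
  · simpa [h] using rho_nonneg j g
  · have hb : b = !a := by cases a <;> cases b <;> simp_all
    have := abs_sub_flipAt_le_rho j g (Function.update σ j a)
    rwa [flipAt_update_self, ← hb] at this

lemma abs_sub_le_sum_rho_of_eq_off (g : (ι → Bool) → ℝ) (s : Finset ι) :
    ∀ σ τ : ι → Bool, (∀ i ∉ s, σ i = τ i) → |g σ - g τ| ≤ ∑ j ∈ s, rho j g := by
  induction s using Finset.induction_on with
  | empty =>
    intro σ τ h
    have : σ = τ := funext fun i => h i (by simp)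
    simp [this]
  | insert a s ha ih =>
    intro σ τ h
    rw [Finset.sum_insert ha]
    have h1 := abs_update_sub_update_le_rho a g σ (σ a) (τ a)
    rw [Function.update_eq_self] at h1
    have h2 := ih (Function.update σ a (τ a)) τ fun i hi => by
      by_cases hia : i = a
      · subst hia; simp
      · rw [Function.update_of_ne hia]
        exact h i (by simp [hia, hi])
    exact (abs_sub_le _ _ _).trans (add_le_add h1 h2)

lemma abs_sub_le_sum_rho (g : (ι → Bool) → ℝ) (σ τ : ι → Bool) :
    |g σ - g τ| ≤ ∑ j, rho j g :=
  abs_sub_le_sum_rho_of_eq_off g univ σ τ fun i hi => absurd (mem_univ i) hi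

lemma rho_sum_le {κ : Type*} (s : Finset κ) (F : κ → (ι → Bool) → ℝ) (j : ι) :
    rho j (fun σ => ∑ k ∈ s, F k σ) ≤ ∑ k ∈ s, rho j (F k) :=
  rho_le fun σ => by
    rw [← Finset.sum_sub_distrib]
    exact (Finset.abs_sum_le_sum_abs _ _).trans
      (Finset.sum_le_sum fun k _ => abs_sub_flipAt_le_rho j (F k) σ)

lemma sum_eq_half_sum_update (F : (ι → Bool) → ℝ) (i : ι) :
    ∑ σ, F σ = (1 / 2) *
      ∑ σ, (F (Function.update σ i true) + F (Function.update σ i false)) := by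
  have h1 : ∑ σ, F (flipAt σ i) = ∑ σ, F σ :=
    Equiv.sum_comp (Function.Involutive.toPerm (fun σ => flipAt σ i)
      fun σ => flipAt_flipAt σ i) F
  have h2 : ∀ σ : ι → Bool, F (Function.update σ i true) + F (Function.update σ i false)
      = F σ + F (flipAt σ i) := by
    intro σ
    rcases h : σ i with _ | _
    · have : Function.update σ i false = σ := by rw [← h, Function.update_eq_self]
      rw [this]
      simp [flipAt, h, add_comm]
    · have : Function.update σ i true = σ := by rw [← h, Function.update_eq_self]
      rw [this]
      simp [flipAt, h]
  simp_rw [h2]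
  rw [Finset.sum_add_distrib, h1]
  ring

end oscillation

section Emean

lemma Emean_sum {α κ : Type*} [Fintype α] (p : α → ℝ) (s : Finset κ) (F : κ → α → ℝ) :
    Emean p (fun x => ∑ k ∈ s, F k x) = ∑ k ∈ s, Emean p (F k) := by
  simp only [Emean, Finset.mul_sum]
  exact Finset.sum_comm

variable {α : Type*} [Fintype α] {p : α → ℝ}

lemma Emean_le_of_le (hp : ∀ x, 0 ≤ p x) (hsum : ∑ x, p x = 1) {f : α → ℝ} {c : ℝ}
    (h : ∀ x, f x ≤ c) : Emean p f ≤ c := by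
  calc Emean p f ≤ ∑ x, p x * c :=
        Finset.sum_le_sum fun x _ => mul_le_mul_of_nonneg_left (h x) (hp x)
    _ = c := by rw [← Finset.sum_mul, hsum, one_mul]

lemma Emean_mul_sq_le (hp : ∀ x, 0 ≤ p x) (f g : α → ℝ) :
    Emean p (fun x => f x * g x) ^ 2 ≤
      Emean p (fun x => f x * f x) * Emean p (fun x => g x * g x) := by
  refine Finset.sum_sq_le_sum_mul_sum_of_sq_le_mul _
    (fun x _ => mul_nonneg (hp x) (mul_self_nonneg _))
    (fun x _ => mul_nonneg (hp x) (mul_self_nonneg _)) fun x _ => le_of_eq ?_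
  ring

lemma Emean_sub (f g : α → ℝ) : Emean p (fun x => f x - g x) = Emean p f - Emean p g := by
  simp [Emean, mul_sub, Finset.sum_sub_distrib]

lemma Emean_const (hsum : ∑ x, p x = 1) (c : ℝ) : Emean p (fun _ => c) = c := by
  simp [Emean, ← Finset.sum_mul, hsum]

lemma Emean_sub_Emean (hsum : ∑ x, p x = 1) (g : α → ℝ) :
    Emean p (fun x => g x - Emean p g) = 0 := by
  rw [Emean_sub, Emean_const hsum, sub_self]

lemma Var_eq_Emean_sub_mul_sub (hsum : ∑ x, p x = 1) (g : α → ℝ) :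
    Var p g = Emean p (fun x => (g x - Emean p g) * (g x - Emean p g)) := by
  have h : ∀ m : ℝ, Emean p (fun x => (g x - m) * (g x - m)) =
      Emean p (fun x => g x ^ 2) - 2 * m * Emean p g + m ^ 2 * ∑ x, p x := by
    intro m
    simp only [Emean, Finset.mul_sum]
    rw [← Finset.sum_sub_distrib, ← Finset.sum_add_distrib]
    exact Finset.sum_congr rfl fun x _ => by ring
  rw [h, hsum, Var]
  ring

end Emean

section heatBath

variable {ι : Type*} [DecidableEq ι]

/-- The heat-bath update at site `i`: the conditional expectation of `g` given the spins
outside `i`. -/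
noncomputable def heatBath (π : (ι → Bool) → ℝ) (i : ι) (g : (ι → Bool) → ℝ)
    (σ : ι → Bool) : ℝ :=
  condProb π i σ * g (Function.update σ i true) +
    (1 - condProb π i σ) * g (Function.update σ i false)

variable {π : (ι → Bool) → ℝ}

lemma condProb_nonneg (hpos : ∀ σ, 0 < π σ) (i : ι) (σ : ι → Bool) : 0 ≤ condProb π i σ :=
  div_nonneg (hpos _).le (add_pos (hpos _) (hpos _)).le

lemma condProb_le_one (hpos : ∀ σ, 0 < π σ) (i : ι) (σ : ι → Bool) : condProb π i σ ≤ 1 :=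
  div_le_one_of_le₀ (by linarith [hpos (Function.update σ i false)])
    (add_pos (hpos _) (hpos _)).le

lemma condProb_update (π : (ι → Bool) → ℝ) (i : ι) (σ : ι → Bool) (b : Bool) :
    condProb π i (Function.update σ i b) = condProb π i σ := by
  simp [condProb]

lemma heatBath_update (π : (ι → Bool) → ℝ) (i : ι) (g : (ι → Bool) → ℝ) (σ : ι → Bool)
    (b : Bool) : heatBath π i g (Function.update σ i b) = heatBath π i g σ := by
  simp [heatBath, condProb_update]

lemma heatBath_heatBath (π : (ι → Bool) → ℝ) (i : ι) (g : (ι → Bool) → ℝ) :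
    heatBath π i (heatBath π i g) = heatBath π i g := by
  funext σ
  rw [heatBath, heatBath_update, heatBath_update]
  ring

lemma heatBath_one (π : (ι → Bool) → ℝ) (i : ι) : heatBath π i (fun _ => 1) = fun _ => 1 := by
  funext σ
  simp [heatBath]

variable [Fintype ι]

/-- The sum of all single-site heat-bath updates. -/
noncomputable def heatBathSum (π : (ι → Bool) → ℝ) (g : (ι → Bool) → ℝ)
    (σ : ι → Bool) : ℝ :=
  ∑ i, heatBath π i g σ

lemma Emean_mul_heatBath (hpos : ∀ σ, 0 < π σ) (i : ι) (f g : (ι → Bool) → ℝ) :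
    Emean π (fun σ => f σ * heatBath π i g σ) = Emean π (fun σ => heatBath π i f σ * g σ) := by
  unfold Emean
  rw [sum_eq_half_sum_update _ i, sum_eq_half_sum_update (fun σ => π σ * (_ * g σ)) i]
  congr 1
  refine Finset.sum_congr rfl fun σ _ => ?_
  simp only [heatBath_update]
  have h := (add_pos (hpos (Function.update σ i true)) (hpos (Function.update σ i false))).ne'
  simp only [heatBath, condProb]
  field_simp
  ring

lemma Emean_heatBath (hpos : ∀ σ, 0 < π σ) (i : ι) (g : (ι → Bool) → ℝ) :
    Emean π (heatBath π i g) = Emean π g := by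
  have := Emean_mul_heatBath hpos i (fun _ => 1) g
  simpa [heatBath_one] using this

lemma abs_sub_heatBath_le (hpos : ∀ σ, 0 < π σ) (i : ι) (g : (ι → Bool) → ℝ) (σ : ι → Bool) :
    |g σ - heatBath π i g σ| ≤ rho i g := by
  have h0 := condProb_nonneg hpos i σ
  have h1 := condProb_le_one hpos i σ
  have ht := abs_update_sub_update_le_rho i g σ (σ i) true
  have hf := abs_update_sub_update_le_rho i g σ (σ i) false
  rw [Function.update_eq_self] at ht hf
  rw [heatBath]
  rw [abs_le] at *
  constructor <;> nlinarith

lemma rho_heatBath_self (π : (ι → Bool) → ℝ) (i : ι) (g : (ι → Bool) → ℝ) :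
    rho i (heatBath π i g) ≤ 0 :=
  rho_le fun σ => by simp [flipAt, heatBath_update]

lemma rho_heatBath_of_ne (hpos : ∀ σ, 0 < π σ) {i j : ι} (h : j ≠ i) (g : (ι → Bool) → ℝ) :
    rho j (heatBath π i g) ≤ rho j g + dobr π i j * rho i g := by
  refine rho_le fun σ => ?_
  have h0 := condProb_nonneg hpos i σ
  have h1 := condProb_le_one hpos i σ
  have ht := abs_sub_flipAt_le_rho j g (Function.update σ i true)
  have hf := abs_sub_flipAt_le_rho j g (Function.update σ i false)
  have hc := abs_condProb_sub_le_dobr π i j σ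
  have hg := abs_update_sub_update_le_rho i g (flipAt σ j) true false
  rw [← update_flipAt_of_ne σ h] at ht hf
  have hcg := mul_le_mul hc hg (abs_nonneg _) ((abs_nonneg _).trans hc)
  rw [← abs_mul] at hcg
  rw [heatBath, heatBath]
  rw [abs_le] at ht hf hcg ⊢
  constructor <;> nlinarith

lemma sum_rho_heatBathSum_le (hpos : ∀ σ, 0 < π σ) {γ : ℝ}
    (hdob : ∀ i, ∑ j ∈ Finset.univ.erase i, dobr π i j ≤ γ) (g : (ι → Bool) → ℝ) :
    ∑ j, rho j (heatBathSum π g) ≤ (Fintype.card ι - 1 + γ) * ∑ j, rho j g := by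
  have key : ∀ i, ∑ j, rho j (heatBath π i g) ≤ ∑ j, rho j g - rho i g + γ * rho i g := by
    intro i
    rw [← Finset.add_sum_erase _ _ (mem_univ i),
      ← Finset.add_sum_erase _ (fun j => rho j g) (mem_univ i)]
    have h1 : ∑ j ∈ univ.erase i, rho j (heatBath π i g)
        ≤ ∑ j ∈ univ.erase i, (rho j g + dobr π i j * rho i g) :=
      Finset.sum_le_sum fun j hj => rho_heatBath_of_ne hpos (Finset.ne_of_mem_erase hj) g
    rw [Finset.sum_add_distrib, ← Finset.sum_mul] at h1
    have h2 := mul_le_mul_of_nonneg_right (hdob i) (rho_nonneg i g)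
    linarith [rho_heatBath_self π i g]
  calc ∑ j, rho j (heatBathSum π g)
      ≤ ∑ j, ∑ i, rho j (heatBath π i g) :=
        Finset.sum_le_sum fun j _ => rho_sum_le univ (fun i => heatBath π i g) j
    _ = ∑ i, ∑ j, rho j (heatBath π i g) := Finset.sum_comm
    _ ≤ ∑ i, (∑ j, rho j g - rho i g + γ * rho i g) := Finset.sum_le_sum fun i _ => key i
    _ = _ := by
      rw [Finset.sum_add_distrib, Finset.sum_sub_distrib, ← Finset.mul_sum]
      simp only [Finset.sum_const, Finset.card_univ, nsmul_eq_mul]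
      ring

lemma Emean_mul_heatBathSum (hpos : ∀ σ, 0 < π σ) (f g : (ι → Bool) → ℝ) :
    Emean π (fun σ => f σ * heatBathSum π g σ) =
      Emean π (fun σ => heatBathSum π f σ * g σ) := by
  simp only [heatBathSum, Finset.mul_sum, Finset.sum_mul, Emean_sum]
  exact Finset.sum_congr rfl fun i _ => Emean_mul_heatBath hpos i f g

lemma Emean_heatBathSum (hpos : ∀ σ, 0 < π σ) (g : (ι → Bool) → ℝ) :
    Emean π (heatBathSum π g) = Fintype.card ι * Emean π g := by
  have : heatBathSum π g = fun σ => ∑ i, heatBath π i g σ := rfl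
  rw [this, Emean_sum]
  simp [Emean_heatBath hpos]

lemma Emean_mul_heatBathSum_iterate (hpos : ∀ σ, 0 < π σ) (m : ℕ) :
    ∀ f g : (ι → Bool) → ℝ, Emean π (fun σ => f σ * (heatBathSum π)^[m] g σ) =
      Emean π (fun σ => (heatBathSum π)^[m] f σ * g σ) := by
  induction m with
  | zero => intro f g; rfl
  | succ m ih =>
    intro f g
    rw [Function.iterate_succ_apply, ih, Emean_mul_heatBathSum hpos,
      ← Function.iterate_succ_apply' (heatBathSum π)]

lemma Emean_heatBathSum_iterate_eq_zero (hpos : ∀ σ, 0 < π σ) {g : (ι → Bool) → ℝ}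
    (hg : Emean π g = 0) (m : ℕ) : Emean π ((heatBathSum π)^[m] g) = 0 := by
  induction m with
  | zero => exact hg
  | succ m ih => rw [Function.iterate_succ_apply', Emean_heatBathSum hpos, ih, mul_zero]

lemma sum_rho_heatBathSum_iterate_le (hpos : ∀ σ, 0 < π σ) {γ : ℝ}
    (hdob : ∀ i, ∑ j ∈ Finset.univ.erase i, dobr π i j ≤ γ)
    (hR : 0 ≤ (Fintype.card ι : ℝ) - 1 + γ) (g : (ι → Bool) → ℝ) (m : ℕ) :
    ∑ j, rho j ((heatBathSum π)^[m] g) ≤ (Fintype.card ι - 1 + γ) ^ m * ∑ j, rho j g := by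
  induction m with
  | zero => simp
  | succ m ih =>
    rw [Function.iterate_succ_apply', pow_succ', mul_assoc]
    exact (sum_rho_heatBathSum_le hpos hdob _).trans (mul_le_mul_of_nonneg_left ih hR)

end heatBath

/-- A sequence whose squares are controlled by its successors, and which grows at most like
`R ^ 2 ^ k`, starts below `R` (up to normalisation). -/
lemma le_mul_of_sq_le_of_le_pow {u : ℕ → ℝ} {A B R : ℝ} (hA : 0 ≤ A) (hR : 0 ≤ R)
    (hsq : ∀ k, u k ^ 2 ≤ A * u (k + 1)) (hle : ∀ k, u k ≤ B * R ^ 2 ^ k) :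
    u 0 ≤ R * A := by
  rcases hA.eq_or_lt with rfl | hA
  · have := hsq 0
    nlinarith [sq_nonneg (u 0)]
  by_contra! hlt
  have hRA : 0 ≤ R * A := mul_nonneg hR hA.le
  have hpow : ∀ k, (u 0 / A) ^ 2 ^ k ≤ u k / A := by
    intro k
    induction k with
    | zero => simp
    | succ k ih =>
      have h0 : 0 ≤ (u 0 / A) ^ 2 ^ k := pow_nonneg (div_nonneg (hRA.trans hlt.le) hA.le) _
      calc (u 0 / A) ^ 2 ^ (k + 1) = ((u 0 / A) ^ 2 ^ k) ^ 2 := by rw [← pow_mul, pow_succ]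
        _ ≤ (u k / A) ^ 2 := pow_le_pow_left₀ h0 ih 2
        _ = u k ^ 2 / (A * A) := by rw [div_pow, sq A]
        _ ≤ A * u (k + 1) / (A * A) := by gcongr; exact hsq k
        _ = u (k + 1) / A := by field_simp
  have hRu : R < u 0 / A := (lt_div_iff₀ hA).2 hlt
  rcases hR.eq_or_lt with rfl | hR
  · have := hle 0
    simp at this
    linarith
  have hone : 1 < u 0 / A / R := (one_lt_div hR).2 hRu
  obtain ⟨n, hn⟩ := pow_unbounded_of_one_lt (B / A) hone
  have h1 : (u 0 / A / R) ^ n ≤ (u 0 / A / R) ^ 2 ^ n :=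
    pow_le_pow_right₀ hone.le Nat.lt_two_pow_self.le
  have h2 : (u 0 / A / R) ^ 2 ^ n ≤ B / A := by
    rw [div_pow, div_le_iff₀ (pow_pos hR _)]
    calc _ ≤ u n / A := hpow n
      _ ≤ B * R ^ 2 ^ n / A := by gcongr; exact hle n
      _ = _ := by ring
  linarith

section poincare

variable {ι : Type*} [Fintype ι] [DecidableEq ι] {π : (ι → Bool) → ℝ}

lemma abs_le_sum_rho_of_Emean_eq_zero (hpos : ∀ σ, 0 < π σ) (hprob : ∑ σ, π σ = 1)
    {g : (ι → Bool) → ℝ} (hg : Emean π g = 0) (σ : ι → Bool) : |g σ| ≤ ∑ j, rho j g := by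
  have h1 : Emean π (fun τ => g τ - g σ) ≤ ∑ j, rho j g :=
    Emean_le_of_le (fun x => (hpos x).le) hprob fun τ =>
      (le_abs_self _).trans (abs_sub_le_sum_rho g τ σ)
  have h2 : Emean π (fun τ => g σ - g τ) ≤ ∑ j, rho j g :=
    Emean_le_of_le (fun x => (hpos x).le) hprob fun τ =>
      (le_abs_self _).trans (abs_sub_le_sum_rho g σ τ)
  rw [Emean_sub, Emean_const hprob, hg] at h1 h2
  rw [abs_le]
  constructor <;> linarith

/-- Under Dobrushin's condition, the sum of heat-bath updates has norm at most `|V| - 1 + γ` on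
centred functions. -/
lemma Emean_mul_heatBathSum_self_le (hpos : ∀ σ, 0 < π σ) (hprob : ∑ σ, π σ = 1) {γ : ℝ}
    (hdob : ∀ i, ∑ j ∈ Finset.univ.erase i, dobr π i j ≤ γ)
    (hR : 0 ≤ (Fintype.card ι : ℝ) - 1 + γ) {f : (ι → Bool) → ℝ} (hf : Emean π f = 0) :
    Emean π (fun σ => f σ * heatBathSum π f σ) ≤
      (Fintype.card ι - 1 + γ) * Emean π (fun σ => f σ * f σ) := by
  have hp : ∀ σ, 0 ≤ π σ := fun σ => (hpos σ).le
  refine le_mul_of_sq_le_of_le_pow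
    (u := fun k => Emean π (fun σ => f σ * (heatBathSum π)^[2 ^ k] f σ))
    (B := (∑ j, rho j f) ^ 2) ?_ hR ?_ ?_
  · exact Finset.sum_nonneg fun σ _ => mul_nonneg (hp σ) (mul_self_nonneg _)
  · intro k
    refine (Emean_mul_sq_le hp f ((heatBathSum π)^[2 ^ k] f)).trans_eq ?_
    rw [← Emean_mul_heatBathSum_iterate hpos (2 ^ k) f, pow_succ, mul_two]
    simp only [Function.iterate_add_apply]
  · intro k
    refine Emean_le_of_le hp hprob fun σ => ?_
    have h1 := abs_le_sum_rho_of_Emean_eq_zero hpos hprob hf σ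
    have h2 := (abs_le_sum_rho_of_Emean_eq_zero hpos hprob
      (Emean_heatBathSum_iterate_eq_zero hpos hf (2 ^ k)) σ).trans
      (sum_rho_heatBathSum_iterate_le hpos hdob hR f (2 ^ k))
    calc f σ * (heatBathSum π)^[2 ^ k] f σ ≤ |f σ| * |(heatBathSum π)^[2 ^ k] f σ| := by
          rw [← abs_mul]; exact le_abs_self _
      _ ≤ (∑ j, rho j f) * ((Fintype.card ι - 1 + γ) ^ 2 ^ k * ∑ j, rho j f) :=
          mul_le_mul h1 h2 (abs_nonneg _) ((abs_nonneg _).trans h1)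
      _ = _ := by ring

lemma Emean_mul_self_sub_heatBath_le (hpos : ∀ σ, 0 < π σ) (hprob : ∑ σ, π σ = 1) (i : ι)
    (f : (ι → Bool) → ℝ) :
    Emean π (fun σ => f σ * f σ) - Emean π (fun σ => f σ * heatBath π i f σ) ≤ rho i f ^ 2 := by
  have h1 : Emean π (fun σ => f σ * heatBath π i f σ) =
      Emean π (fun σ => heatBath π i f σ * heatBath π i f σ) := by
    rw [← Emean_mul_heatBath hpos i f (heatBath π i f), heatBath_heatBath]
  have h2 : Emean π (fun σ => (f σ - heatBath π i f σ) ^ 2) =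
      Emean π (fun σ => f σ * f σ) - Emean π (fun σ => f σ * heatBath π i f σ) -
      (Emean π (fun σ => f σ * heatBath π i f σ) -
        Emean π (fun σ => heatBath π i f σ * heatBath π i f σ)) := by
    rw [← Emean_sub, ← Emean_sub, ← Emean_sub]
    congr 1
    funext σ
    ring
  rw [← h1, sub_self, sub_zero] at h2
  rw [← h2]
  exact Emean_le_of_le (fun σ => (hpos σ).le) hprob fun σ =>
    sq_le_sq' (abs_le.1 (abs_sub_heatBath_le hpos i f σ)).1
      (abs_le.1 (abs_sub_heatBath_le hpos i f σ)).2

/-- Under Dobrushin's condition, the variance is controlled by the squared oscillations. -/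
theorem Var_le_sum_sq_rho [Nonempty ι] (hpos : ∀ σ, 0 < π σ) (hprob : ∑ σ, π σ = 1) {γ : ℝ}
    (hγ0 : 0 ≤ γ) (hγ : γ < 1) (hdob : ∀ i, ∑ j ∈ Finset.univ.erase i, dobr π i j ≤ γ)
    (g : (ι → Bool) → ℝ) : Var π g ≤ (∑ i, rho i g ^ 2) / (1 - γ) := by
  set f : (ι → Bool) → ℝ := fun σ => g σ - Emean π g with hfdef
  have hf : Emean π f = 0 := Emean_sub_Emean hprob g
  have hrho : ∀ i, rho i f = rho i g := fun i => by simp [rho, hfdef]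
  have hcard : (1 : ℝ) ≤ Fintype.card ι := by exact_mod_cast Fintype.card_pos
  have hgap := Emean_mul_heatBathSum_self_le hpos hprob hdob (by linarith) hf
  have hloc := Finset.sum_le_sum fun i (_ : i ∈ univ) =>
    Emean_mul_self_sub_heatBath_le hpos hprob i f
  simp only [heatBathSum, Finset.mul_sum, Emean_sum] at hgap
  simp only [Finset.sum_sub_distrib, Finset.sum_const, Finset.card_univ, nsmul_eq_mul,
    hrho] at hloc
  rw [Var_eq_Emean_sub_mul_sub hprob, le_div_iff₀ (by linarith)]
  change Emean π (fun σ => f σ * f σ) * (1 - γ) ≤ _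
  linarith

end poincare

section rates

lemma abs_exp_sub_exp_le {a b M : ℝ} (ha : a ≤ M) (hb : b ≤ M) :
    |Real.exp a - Real.exp b| ≤ Real.exp M * |a - b| := by
  wlog h : b ≤ a generalizing a b
  · rw [abs_sub_comm, abs_sub_comm a b]
    exact this hb ha (le_of_not_ge h)
  rw [abs_of_nonneg (sub_nonneg.2 (Real.exp_le_exp.2 h)), abs_of_nonneg (sub_nonneg.2 h)]
  have h1 : Real.exp b = Real.exp a * Real.exp (b - a) := by rw [← Real.exp_add]; congr 1; ring
  have h2 : 1 - Real.exp (b - a) ≤ a - b := by linarith [Real.add_one_le_exp (b - a)]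
  calc Real.exp a - Real.exp b = Real.exp a * (1 - Real.exp (b - a)) := by rw [h1]; ring
    _ ≤ Real.exp a * (a - b) := mul_le_mul_of_nonneg_left h2 (Real.exp_pos a).le
    _ ≤ Real.exp M * (a - b) :=
      mul_le_mul_of_nonneg_right (Real.exp_le_exp.2 ha) (sub_nonneg.2 h)

lemma abs_div_one_add_mul_sub_le {δ x y : ℝ} (hδ : 0 ≤ δ) (hx : 0 ≤ x) (hy : 0 ≤ y) :
    |x / (1 + δ * x) - y / (1 + δ * y)| ≤ |x - y| := by
  have h1 : 1 ≤ 1 + δ * x := by nlinarith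
  have h2 : 1 ≤ 1 + δ * y := by nlinarith
  have h : x / (1 + δ * x) - y / (1 + δ * y) = (x - y) / ((1 + δ * x) * (1 + δ * y)) := by
    field_simp
    ring
  rw [h, abs_div]
  exact div_le_self (abs_nonneg _) ((one_le_mul_of_one_le_of_one_le h1 h2).trans (le_abs_self _))

lemma abs_spin (b : Bool) : |spin b| = 1 := by
  cases b <;> simp [spin]

lemma spin_not (b : Bool) : spin (!b) = -spin b := by
  cases b <;> simp [spin]

variable {ι : Type*} [Fintype ι] {J : ι → ι → ℝ} {Jbar : ℝ}

lemma neg_two_mul_sum_le (hJbar : ∀ i, ∑ j, |J i j| ≤ Jbar) (i : ι) (σ : ι → Bool) :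
    -2 * ∑ j, J i j * spin (σ i) * spin (σ j) ≤ 2 * Jbar := by
  have h := Finset.abs_sum_le_sum_abs (fun j => J i j * spin (σ i) * spin (σ j)) univ
  simp only [abs_mul, abs_spin, mul_one] at h
  linarith [(abs_le.1 (h.trans (hJbar i))).1]

variable [DecidableEq ι]

lemma abs_phi_sub_phi_flipAt_self_le (hJbar : ∀ i, ∑ j, |J i j| ≤ Jbar) (i : ι)
    (σ : ι → Bool) : |phi J i σ - phi J i (flipAt σ i)| ≤ Real.exp (2 * Jbar) := by
  have h : ∀ τ, 0 < phi J i τ ∧ phi J i τ ≤ Real.exp (2 * Jbar) := fun τ =>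
    ⟨Real.exp_pos _, Real.exp_le_exp.2 (neg_two_mul_sum_le hJbar i τ)⟩
  have h1 := h σ
  have h2 := h (flipAt σ i)
  rw [abs_le]
  constructor <;> linarith

lemma abs_phi_sub_phi_flipAt_of_ne_le (hJbar : ∀ i, ∑ j, |J i j| ≤ Jbar) {i j : ι}
    (hij : i ≠ j) (σ : ι → Bool) :
    |phi J i σ - phi J i (flipAt σ j)| ≤ Real.exp (2 * Jbar) * (4 * |J i j|) := by
  refine (abs_exp_sub_exp_le (neg_two_mul_sum_le hJbar i σ)
    (neg_two_mul_sum_le hJbar i (flipAt σ j))).trans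
    (mul_le_mul_of_nonneg_left ?_ (Real.exp_pos _).le)
  have hi : flipAt σ j i = σ i := by simp [flipAt, hij]
  have hj : flipAt σ j j = !σ j := by simp [flipAt]
  have h : ∑ k, J i k * spin (σ i) * spin (σ k) -
      ∑ k, J i k * spin (flipAt σ j i) * spin (flipAt σ j k) =
      J i j * spin (σ i) * (2 * spin (σ j)) := by
    rw [← Finset.sum_sub_distrib, Finset.sum_eq_single j]
    · rw [hi, hj, spin_not]
      ring
    · intro k _ hk
      have : flipAt σ j k = σ k := by simp [flipAt, hk]
      rw [hi, this, sub_self]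
    · simp
  rw [← mul_sub, h]
  simp only [abs_mul, abs_spin]
  norm_num
  linarith

lemma rho_Gsum_le (hsym : ∀ i j, J i j = J j i) (hJbar : ∀ i, ∑ j, |J i j| ≤ Jbar) {δ : ℝ}
    (hδ : 0 ≤ δ) (j : ι) : rho j (Gsum J δ) ≤ Real.exp (2 * Jbar) * (1 + 4 * Jbar) := by
  refine rho_le fun σ => ?_
  have hphi : ∀ i τ, 0 ≤ phi J i τ := fun i τ => (Real.exp_pos _).le
  have hoff : ∑ i ∈ univ.erase j, |J i j| ≤ Jbar := by
    refine (Finset.sum_le_univ_sum_of_nonneg fun i => abs_nonneg _).trans ?_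
    simpa only [hsym j] using hJbar j
  calc |Gsum J δ σ - Gsum J δ (flipAt σ j)|
      ≤ ∑ i, |phi J i σ - phi J i (flipAt σ j)| := by
        rw [Gsum, Gsum, ← Finset.sum_sub_distrib]
        exact (Finset.abs_sum_le_sum_abs _ _).trans (Finset.sum_le_sum fun i _ =>
          abs_div_one_add_mul_sub_le hδ (hphi i _) (hphi i _))
    _ = |phi J j σ - phi J j (flipAt σ j)| +
          ∑ i ∈ univ.erase j, |phi J i σ - phi J i (flipAt σ j)| :=
        (Finset.add_sum_erase _ _ (mem_univ j)).symm
    _ ≤ Real.exp (2 * Jbar) + ∑ i ∈ univ.erase j, Real.exp (2 * Jbar) * (4 * |J i j|) :=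
        add_le_add (abs_phi_sub_phi_flipAt_self_le hJbar j σ) (Finset.sum_le_sum fun i hi =>
          abs_phi_sub_phi_flipAt_of_ne_le hJbar (Finset.ne_of_mem_erase hi) σ)
    _ = Real.exp (2 * Jbar) * (1 + 4 * ∑ i ∈ univ.erase j, |J i j|) := by
        rw [← Finset.mul_sum, ← Finset.mul_sum]; ring
    _ ≤ _ := by gcongr

end rates

/-- If `π` is a strictly positive probability whose Dobrushin coefficients satisfy
`max_i Σ_{j≠i} γ_{ij} ≤ γ < 1` and `J̄ ≥ max_i Σ_j |J_{ij}|`, then with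
`C = e^{4J̄}(1+4J̄)²/(1-γ)` (a constant depending only on `J̄` and `γ`), for every `δ ≥ 0`,
`(1/|V|) Var_π[Σ_i φ_i/(1+δφ_i)] ≤ C`. -/
theorem variance_bound_of_dobrushin_coeffs {ι : Type*} [Fintype ι] [DecidableEq ι] [Nonempty ι]
    (J : ι → ι → ℝ) (hsym : ∀ i j, J i j = J j i) (hdiag : ∀ i, J i i = 0)
    (π : (ι → Bool) → ℝ) (hpos : ∀ σ, 0 < π σ) (hprob : ∑ σ : ι → Bool, π σ = 1)
    (γ : ℝ) (hγ0 : 0 ≤ γ) (hγ : γ < 1)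
    (hdob : ∀ i, ∑ j ∈ Finset.univ.erase i, dobr π i j ≤ γ)
    (Jbar : ℝ) (hJbar : ∀ i, ∑ j, |J i j| ≤ Jbar) :
    ∃ C : ℝ, C = Real.exp (4 * Jbar) * (1 + 4 * Jbar) ^ 2 / (1 - γ) ∧
      ∀ δ : ℝ, 0 ≤ δ →
        (1 / (Fintype.card ι : ℝ)) * Var π (Gsum J δ) ≤ C := by
  refine ⟨_, rfl, fun δ hδ => ?_⟩
  have hcard : (0 : ℝ) < Fintype.card ι := by exact_mod_cast Fintype.card_pos
  have hγ1 : 0 < 1 - γ := sub_pos.2 hγ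
  have hsum : ∑ i, rho i (Gsum J δ) ^ 2 ≤
      Fintype.card ι * (Real.exp (4 * Jbar) * (1 + 4 * Jbar) ^ 2) := by
    have hexp : Real.exp (4 * Jbar) = Real.exp (2 * Jbar) ^ 2 := by
      rw [← Real.exp_nat_mul]; congr 1; push_cast; ring
    rw [hexp, ← mul_pow]
    refine (Finset.sum_le_card_nsmul univ _ _ fun i _ => pow_le_pow_left₀ (rho_nonneg i _)
      (rho_Gsum_le hsym hJbar hδ i) 2).trans_eq ?_
    rw [Finset.card_univ, nsmul_eq_mul]
  calc (1 / (Fintype.card ι : ℝ)) * Var π (Gsum J δ)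
      ≤ (1 / (Fintype.card ι : ℝ)) *
        (Fintype.card ι * (Real.exp (4 * Jbar) * (1 + 4 * Jbar) ^ 2) / (1 - γ)) := by
        gcongr
        exact (Var_le_sum_sq_rho hpos hprob hγ0 hγ hdob _).trans
          (div_le_div_of_nonneg_right hsum hγ1.le)
    _ = Real.exp (4 * Jbar) * (1 + 4 * Jbar) ^ 2 / (1 - γ) := by
        field_simp
end

section
/- For the mean-field (Curie–Weiss) pair Hamiltonian, the PCA normalization factorizes as: for every σ ∈ {−1,1}^n, Z_σ := Σ_{τ∈{−1,1}^n} e^{−H_{CW}(σ,τ)} = e^{(J/2) n m(σ)²} (1 + δ e^{−J m(σ)})^{n(1+m(σ))/2} (1 + δ e^{J m(σ)})^{n(1−m(σ))/2}, where δ = e^{−2q}. -/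
open Finset

/-- Magnetization `m(σ) = (1/n) Σ_i σ_i`. -/
noncomputable def mag {n : ℕ} (σ : Fin n → Bool) : ℝ := (1 / (n : ℝ)) * ∑ i, spin (σ i)

/-- Curie–Weiss pair Hamiltonian
`H_CW(σ,σ') = -(J/(2n)) Σ_{i,j} σ_i σ'_j + q Σ_i (1 - σ_i σ'_i)`. -/
noncomputable def Hcw (n : ℕ) (J q : ℝ) (σ σ' : Fin n → Bool) : ℝ :=
  -(J / (2 * n)) * ∑ i, ∑ j, spin (σ i) * spin (σ' j) +
    q * ∑ i, (1 - spin (σ i) * spin (σ' i))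

/-- `Z_σ = Σ_τ e^{-H_CW(σ,τ)}`. -/
noncomputable def Zcw (n : ℕ) (J q : ℝ) (σ : Fin n → Bool) : ℝ :=
  ∑ τ : Fin n → Bool, Real.exp (-Hcw n J q σ τ)

/-- Curie–Weiss PCA transition probability `P^{PCA}(σ,σ') = e^{-H_CW(σ,σ')}/Z_σ`. -/
noncomputable def Pcw (n : ℕ) (J q : ℝ) (σ σ' : Fin n → Bool) : ℝ :=
  Real.exp (-Hcw n J q σ σ') / Zcw n J q σ

/-- Curie–Weiss PCA stationary measure `π^{PCA}(σ) = Z_σ / Σ_τ Z_τ`. -/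
noncomputable def piCW (n : ℕ) (J q : ℝ) (σ : Fin n → Bool) : ℝ :=
  Zcw n J q σ / ∑ τ : Fin n → Bool, Zcw n J q τ

lemma Zcw_eq_prod_sum_exp {n : ℕ} (hn : n ≠ 0) (J q : ℝ) (σ : Fin n → Bool) :
    Zcw n J q σ = ∏ i, ∑ b : Bool,
      Real.exp (J * mag σ / 2 * spin b - q * (1 - spin (σ i) * spin b)) := by
  rw [Finset.prod_univ_sum, Fintype.piFinset_univ]
  refine Finset.sum_congr rfl fun τ _ => ?_
  rw [← Real.exp_sum, Finset.sum_sub_distrib, ← Finset.mul_sum, ← Finset.mul_sum, Hcw, mag,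
    ← Finset.sum_mul_sum]
  congr 1
  have : (n : ℝ) ≠ 0 := Nat.cast_ne_zero.2 hn
  field_simp
  ring

lemma sum_exp_site_eq (a q : ℝ) (s : Bool) :
    ∑ b : Bool, Real.exp (a / 2 * spin b - q * (1 - spin s * spin b)) =
      Real.exp (a / 2 * spin s) *
        ((1 + Real.exp (-2 * q) * Real.exp (-a)) ^ ((1 + spin s) / 2) *
          (1 + Real.exp (-2 * q) * Real.exp a) ^ ((1 - spin s) / 2)) := by
  cases s <;>
    norm_num [spin, mul_add, ← Real.exp_add] <;>
    ring_nf

/-- For the Curie–Weiss pair Hamiltonian, the PCA normalization factorizes: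
`Z_σ = e^{(J/2)n m(σ)²} (1 + δe^{-Jm(σ)})^{n(1+m(σ))/2} (1 + δe^{Jm(σ)})^{n(1-m(σ))/2}`. -/
theorem curie_weiss_Z_factorization (n : ℕ) (hn : 1 ≤ n) (J q : ℝ) (hJ : 0 < J)
    (hq : 0 ≤ q) (δ : ℝ) (hδ : δ = Real.exp (-2 * q)) (σ : Fin n → Bool) :
    Zcw n J q σ =
      Real.exp ((J / 2) * n * (mag σ) ^ 2) *
        (1 + δ * Real.exp (-(J * mag σ))) ^ (((n : ℝ) * (1 + mag σ) / 2) : ℝ) *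
        (1 + δ * Real.exp (J * mag σ)) ^ (((n : ℝ) * (1 - mag σ) / 2) : ℝ) := by
  have hn0 : n ≠ 0 := by omega
  have hnr : (n : ℝ) ≠ 0 := Nat.cast_ne_zero.2 hn0
  have hs : ∑ i, spin (σ i) = n * mag σ := by
    rw [mag]
    field_simp
  have hc : ∑ _i : Fin n, (1 : ℝ) = n := by simp
  subst hδ
  rw [Zcw_eq_prod_sum_exp hn0]
  simp_rw [sum_exp_site_eq]
  rw [Finset.prod_mul_distrib, Finset.prod_mul_distrib, ← Real.exp_sum, ← Finset.mul_sum,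
    ← Real.rpow_sum_of_pos (by positivity), ← Real.rpow_sum_of_pos (by positivity),
    ← Finset.sum_div, ← Finset.sum_div, Finset.sum_add_distrib, Finset.sum_sub_distrib,
    hs, hc, ← mul_assoc]
  ring_nf
end
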